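/- arXiv:math/9911103 — 3 statements merged into one kernel-verified Lean document; each statement's English description precedes it below -/
import Mathlib

section
/- Let Γ be a group acting on a nonempty set X, let x₀ ∈ X, and let φ : Γ → (X → ℝ) be a family of functions such that (i) for all γ, γ' ∈ Γ the function x ↦ φ_γ(x) + φ_{γ'}(γ·x) − φ_{γ'γ}(x) is constant on X, and (ii) φ_γ(x₀) = 0 for all γ ∈ Γ. For each γ ∈ Γ define the linear operator T_γ on complex-valued functions on X by (T_γ u)(x) = exp(i φ_γ(γ⁻¹·x)) · u(γ⁻¹·x), and define σ̄ : Γ × Γ → ℂ by σ̄(γ,γ') = exp(i φ_γ(γ'·x₀)). Then T defines a projective (Γ,σ̄)-action: T_γ ∘ T_{γ'} = σ̄(γ,γ') • T_{γγ'} for all γ, γ' ∈ Γ. -/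
/-- The operators `T_γ u = e^{iφ_γ(γ⁻¹·x)} u(γ⁻¹·x)` define a projective
`(Γ, σ̄)`-action on complex-valued functions on `X`, where
`σ̄(γ,γ') = exp(i φ_γ(γ'·x₀))`. -/
theorem projective_action_of_phase
    {Γ : Type*} [Group Γ] {X : Type*} [Nonempty X] [MulAction Γ X]
    (x₀ : X) (φ : Γ → X → ℝ)
    (hconst : ∀ γ γ' : Γ, ∃ C : ℝ, ∀ x : X,
      φ γ x + φ γ' (γ • x) - φ (γ' * γ) x = C)
    (hnorm : ∀ γ : Γ, φ γ x₀ = 0)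
    (T : Γ → (X → ℂ) →ₗ[ℂ] (X → ℂ))
    (hT : ∀ (γ : Γ) (u : X → ℂ) (x : X),
      T γ u x = Complex.exp (Complex.I * (φ γ (γ⁻¹ • x) : ℝ)) * u (γ⁻¹ • x))
    (σ : Γ → Γ → ℂ)
    (hσ : ∀ γ γ' : Γ, σ γ γ' = Complex.exp (Complex.I * (φ γ (γ' • x₀) : ℝ))) :
    ∀ γ γ' : Γ, (T γ).comp (T γ') = σ γ γ' • T (γ * γ') := by
  intro γ γ'
  have cocycle (y : X) : φ γ (γ' • y) + φ γ' y = φ γ (γ' • x₀) + φ (γ * γ') y := by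
    obtain ⟨C, hC⟩ := hconst γ' γ
    linarith [hC y, hC x₀, hnorm γ', hnorm (γ * γ')]
  ext1 u
  funext x
  have h := cocycle ((γ * γ')⁻¹ • x)
  rw [smul_smul, mul_inv_rev, mul_inv_cancel_left] at h
  simp only [LinearMap.comp_apply, LinearMap.smul_apply, Pi.smul_apply, smul_eq_mul, hT, hσ,
    smul_smul, mul_inv_rev, ← mul_assoc, ← Complex.exp_add, ← mul_add, ← Complex.ofReal_add, h]
end

section
/- Let H₁, H₂ be complex Hilbert spaces, D : H₁ → H₂ a bounded linear operator, and t > 0. Write A = D* ∘ D (a positive self-adjoint bounded operator on H₁) and B = D ∘ D* (on H₂). Let g_t : ℝ → ℝ be the continuous function with g_t(x) = (1 − exp(−t x/2))/x for x ≠ 0 and g_t(0) = t/2, and define Q_t = (cfc g_t A) ∘ D* : H₂ → H₁, where cfc denotes the continuous functional calculus. Then Q_t ∘ D = 1_{H₁} − cfc (x ↦ exp(−t x/2)) A, and D ∘ Q_t = 1_{H₂} − cfc (x ↦ exp(−t x/2)) B. In other words, Q_t is a parametrix for D with remainders R₀(t) = e^{−(t/2) D*D} and R₁(t) = e^{−(t/2)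 DD*}. -/
section Intertwining

variable {H₁ H₂ : Type*}
  [NormedAddCommGroup H₁] [InnerProductSpace ℂ H₁]
  [NormedAddCommGroup H₂] [InnerProductSpace ℂ H₂]

theorem comp_pow_eq_pow_comp {A : H₁ →L[ℂ] H₁} {B : H₂ →L[ℂ] H₂} {T : H₁ →L[ℂ] H₂}
    (hT : T.comp A = B.comp T) (n : ℕ) : T.comp (A ^ n) = (B ^ n).comp T := by
  induction n with
  | zero => ext x; simp
  | succ n ih =>
    calc T.comp (A ^ (n + 1)) = (T.comp (A ^ n)).comp A := by
          rw [pow_succ]; rfl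
      _ = (B ^ n).comp (T.comp A) := by rw [ih]; rfl
      _ = (B ^ (n + 1)).comp T := by rw [hT, pow_succ]; rfl

theorem comp_aeval_eq_aeval_comp {A : H₁ →L[ℂ] H₁} {B : H₂ →L[ℂ] H₂} {T : H₁ →L[ℂ] H₂}
    (hT : T.comp A = B.comp T) (p : Polynomial ℝ) :
    T.comp (Polynomial.aeval A p) = (Polynomial.aeval B p).comp T := by
  induction p using Polynomial.induction_on' with
  | add p q hp hq => simp only [map_add, ContinuousLinearMap.comp_add,
      ContinuousLinearMap.add_comp, hp, hq]
  | monomial n r =>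
    have h := comp_pow_eq_pow_comp hT n
    ext x
    have hx : T ((A ^ n) x) = (B ^ n) (T x) := congrArg (fun S : H₁ →L[ℂ] H₂ => S x) h
    simp only [Polynomial.aeval_monomial, ← Algebra.smul_def, ContinuousLinearMap.comp_apply,
      smul_apply, ← hx]
    exact T.map_smul_of_tower r _

variable [CompleteSpace H₁] [CompleteSpace H₂]

theorem norm_cfc_sub_aeval_le {A : H₁ →L[ℂ] H₁} (hA : IsSelfAdjoint A) {f : ℝ → ℝ}
    (hf : Continuous f) {p : Polynomial ℝ} {R ε : ℝ} (hε : 0 ≤ ε) (hR : ‖A‖ ≤ R)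
    (hp : ∀ x ∈ Set.Icc (-R) R, |p.eval x - f x| ≤ ε) :
    ‖cfc f A - Polynomial.aeval A p‖ ≤ ε := by
  rw [← cfc_polynomial p A hA, ← cfc_sub f p.eval A hf.continuousOn p.continuous.continuousOn]
  refine norm_cfc_le hε fun x hx => ?_
  have hxA : ‖x‖ ≤ ‖A‖ := by
    rcases subsingleton_or_nontrivial H₁ with h | h
    · simp [spectrum.of_subsingleton] at hx
    · exact spectrum.norm_le_norm_of_mem hx
  rw [norm_sub_rev]
  exact hp x (abs_le.mp (hxA.trans hR))

/-- An operator intertwining two self-adjoint operators intertwines their continuous functions. -/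
theorem comp_cfc_eq_cfc_comp {A : H₁ →L[ℂ] H₁} {B : H₂ →L[ℂ] H₂} {T : H₁ →L[ℂ] H₂}
    (hA : IsSelfAdjoint A) (hB : IsSelfAdjoint B) (hT : T.comp A = B.comp T)
    {f : ℝ → ℝ} (hf : Continuous f) : T.comp (cfc f A) = (cfc f B).comp T := by
  have key : ∀ ε > 0, ‖T.comp (cfc f A) - (cfc f B).comp T‖ ≤ ε * (2 * ‖T‖) := by
    intro ε hε
    obtain ⟨p, hpA, hpB⟩ : ∃ p : Polynomial ℝ, ‖cfc f A - Polynomial.aeval A p‖ ≤ ε ∧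
        ‖cfc f B - Polynomial.aeval B p‖ ≤ ε := by
      obtain ⟨p, hp⟩ := exists_polynomial_near_of_continuousOn (-max ‖A‖ ‖B‖) (max ‖A‖ ‖B‖) f
        hf.continuousOn ε hε
      exact ⟨p, norm_cfc_sub_aeval_le hA hf hε.le (le_max_left _ _) fun x hx => (hp x hx).le,
        norm_cfc_sub_aeval_le hB hf hε.le (le_max_right _ _) fun x hx => (hp x hx).le⟩
    have h := comp_aeval_eq_aeval_comp hT p
    calc ‖T.comp (cfc f A) - (cfc f B).comp T‖
        = ‖T.comp (cfc f A - Polynomial.aeval A p)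
            - (cfc f B - Polynomial.aeval B p).comp T‖ := by
          rw [ContinuousLinearMap.comp_sub, ContinuousLinearMap.sub_comp, h]
          congr 1; abel
      _ ≤ ‖T‖ * ‖cfc f A - Polynomial.aeval A p‖ + ‖cfc f B - Polynomial.aeval B p‖ * ‖T‖ :=
          (norm_sub_le _ _).trans (add_le_add (ContinuousLinearMap.opNorm_comp_le _ _)
            (ContinuousLinearMap.opNorm_comp_le _ _))
      _ ≤ ‖T‖ * ε + ε * ‖T‖ := by gcongr
      _ = ε * (2 * ‖T‖) := by ring
  rw [← sub_eq_zero, ← norm_le_zero_iff]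
  refine le_of_forall_pos_le_add fun δ hδ => ?_
  refine (key (δ / (2 * ‖T‖ + 1)) (by positivity)).trans ?_
  rw [zero_add, div_mul_eq_mul_div, div_le_iff₀ (by positivity)]
  nlinarith [norm_nonneg T]

theorem cfc_mul_self_eq_one_sub_cfc {A : H₁ →L[ℂ] H₁} (hA : IsSelfAdjoint A) {g h : ℝ → ℝ}
    (hg : Continuous g) (hh : Continuous h) (hgh : ∀ x, g x * x = 1 - h x) :
    cfc g A * A = 1 - cfc h A := by
  calc cfc g A * A = cfc g A * cfc (fun x : ℝ => x) A := by rw [cfc_id' ℝ A hA]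
    _ = cfc (fun x => 1 - h x) A := by
      rw [← cfc_mul g (fun x => x) A hg.continuousOn continuousOn_id]
      simp only [hgh]
    _ = 1 - cfc h A := by
      rw [cfc_sub (fun _ => 1) h A continuousOn_const hh.continuousOn, cfc_const_one ℝ A hA]

end Intertwining

open ContinuousLinearMap in
/-- for a bounded operator `D : H₁ → H₂` and `t > 0`, the operator
`Q_t = g_t(D*D) ∘ D*`, where `g_t(x) = (1 − e^{−tx/2})/x` (extended by `g_t(0) = t/2`),
is a parametrix for `D` with remainders `e^{−(t/2)D*D}` and `e^{−(t/2)DD*}`. -/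
theorem heat_parametrix
    {H₁ H₂ : Type*}
    [NormedAddCommGroup H₁] [InnerProductSpace ℂ H₁] [CompleteSpace H₁]
    [NormedAddCommGroup H₂] [InnerProductSpace ℂ H₂] [CompleteSpace H₂]
    (D : H₁ →L[ℂ] H₂) (t : ℝ) (ht : 0 < t)
    (A : H₁ →L[ℂ] H₁) (hA : A = (adjoint D).comp D)
    (B : H₂ →L[ℂ] H₂) (hB : B = D.comp (adjoint D))
    (g : ℝ → ℝ) (hgcont : Continuous g) (hg0 : g 0 = t / 2)
    (hg : ∀ x : ℝ, x ≠ 0 → g x = (1 - Real.exp (-(t * x) / 2)) / x)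
    (Q : H₂ →L[ℂ] H₁) (hQ : Q = (cfc g A).comp (adjoint D)) :
    Q.comp D = 1 - cfc (fun x : ℝ => Real.exp (-(t * x) / 2)) A ∧
    D.comp Q = 1 - cfc (fun x : ℝ => Real.exp (-(t * x) / 2)) B := by
  have hexp : Continuous fun x : ℝ => Real.exp (-(t * x) / 2) := by fun_prop
  have hmul : ∀ x, g x * x = 1 - Real.exp (-(t * x) / 2) := by
    intro x
    rcases eq_or_ne x 0 with rfl | hx
    · simp
    · rw [hg x hx, div_mul_cancel₀ _ hx]
  have hAsa : IsSelfAdjoint A := by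
    rw [hA]; exact IsSelfAdjoint.of_nonneg (by
      rw [ContinuousLinearMap.nonneg_iff_isPositive]; exact isPositive_adjoint_comp_self D)
  have hBsa : IsSelfAdjoint B := by
    rw [hB]; exact IsSelfAdjoint.of_nonneg (by
      rw [ContinuousLinearMap.nonneg_iff_isPositive]; exact isPositive_self_comp_adjoint D)
  have hDAB : D.comp A = B.comp D := by rw [hA, hB]; rfl
  constructor
  · rw [← cfc_mul_self_eq_one_sub_cfc hAsa hgcont hexp hmul, hQ, hA]; rfl
  · calc D.comp Q = (D.comp (cfc g A)).comp (adjoint D) := by rw [hQ]; rfl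
      _ = cfc g B * B := by
        rw [comp_cfc_eq_cfc_comp hAsa hBsa hDAB hgcont, hB]; rfl
      _ = _ := cfc_mul_self_eq_one_sub_cfc hBsa hgcont hexp hmul
end

section
/- Let Γ be a countable group acting on a σ-finite measure space (X, μ) by measurable measure-preserving bijections, and let F ⊆ X be a measurable fundamental domain for the action. Let φ : Γ → (X → ℝ), let N be a natural number, and let k_A, k_B : X × X → Matrix (Fin N) (Fin N) ℂ be measurable kernels each satisfying the twisted equivariance condition exp(i φ_γ(x)) · k(γ·x, γ·y) · exp(−i φ_γ(y)) = k(x,y) for all γ ∈ Γ and x, y ∈ X. Assume the functions (x,y) ↦ ‖k_A(x,y)‖·‖k_B(y,x)‖ and (x,y) ↦ ‖k_B(x,y)‖·‖k_A(y,x)‖ are integrable on F × X. Then the von Neumann trace is symmetric: ∫_{x ∈ F} Tr( ∫_{y ∈ X} k_A(x,y) · k_B(y,x) dμ(y) ) dμ(x) = ∫_{x ∈ F} Tr( ∫_{y ∈ X} k_B(x,y) · k_A(y,x) dμ(y) ) dμ(x), where Tr denotes the matrix trace. -/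
open MeasureTheory Complex

attribute [local instance] Matrix.normedAddCommGroup Matrix.normedSpace

/-- The entrywise (product) measurable structure on matrices. -/
local instance {m n α : Type*} [MeasurableSpace α] : MeasurableSpace (Matrix m n α) :=
  inferInstanceAs (MeasurableSpace (m → n → α))

/-- A fundamental domain pulls back along an equivariant quasi-measure-preserving map. -/
theorem MeasureTheory.IsFundamentalDomain.preimage_of_equivariant
    {G α β : Type*} [Group G] [MulAction G α] [MulAction G β]
    [MeasurableSpace α] [MeasurableSpace β] {μ : Measure α} {ν : Measure β} {s : Set α}
    (h : IsFundamentalDomain G s μ) {f : β → α} (hf : Measure.QuasiMeasurePreserving f ν μ)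
    (hequiv : ∀ (g : G) (x : β), f (g • x) = g • f x) :
    IsFundamentalDomain G (f ⁻¹' s) ν :=
  h.preimage_of_equiv hf Function.bijective_id fun g x => hequiv g x

/-- For a diagonally invariant function on `X × X`, the two coordinates can be exchanged in an
integral over a fundamental domain in the first coordinate. -/
theorem setIntegral_prod_swap_of_invariant
    {Γ X E : Type*} [Group Γ] [Countable Γ] [MulAction Γ X] [MeasurableSpace X]
    [NormedAddCommGroup E] [NormedSpace ℝ E]
    {μ : Measure X} [SigmaFinite μ]
    (hpres : ∀ γ : Γ, MeasurePreserving (fun x : X => γ • x) μ μ)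
    {F : Set X} (hF : IsFundamentalDomain Γ F μ) (f : X × X → E)
    (hf : ∀ (γ : Γ) (p : X × X), f (γ • p) = f p) :
    ∫ p in F ×ˢ Set.univ, f p ∂μ.prod μ = ∫ p in F ×ˢ Set.univ, f p.swap ∂μ.prod μ := by
  have hdiag : ∀ γ : Γ, MeasurePreserving (fun p : X × X => γ • p) (μ.prod μ) (μ.prod μ) :=
    fun γ => (hpres γ).prod (hpres γ)
  have : MeasurableConstSMul Γ (X × X) := ⟨fun γ => (hdiag γ).measurable⟩
  have : SMulInvariantMeasure Γ (X × X) (μ.prod μ) :=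
    ⟨fun γ _ hs => (hdiag γ).measure_preimage hs.nullMeasurableSet⟩
  have hfst : IsFundamentalDomain Γ (Prod.fst ⁻¹' F : Set (X × X)) (μ.prod μ) :=
    hF.preimage_of_equivariant Measure.quasiMeasurePreserving_fst fun _ _ => rfl
  have hsnd : IsFundamentalDomain Γ (Prod.snd ⁻¹' F : Set (X × X)) (μ.prod μ) :=
    hF.preimage_of_equivariant Measure.quasiMeasurePreserving_snd fun _ _ => rfl
  rw [Set.prod_univ, hfst.setIntegral_eq hsnd hf]
  exact (Measure.measurePreserving_swap.setIntegral_preimage_emb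
    MeasurableEquiv.prodComm.measurableEmbedding f (Prod.snd ⁻¹' F)).symm

section Kernel

variable {X : Type*} [MeasurableSpace X] {n : Type*} [Fintype n]

theorem Matrix.norm_mul_le_card_mul (A B : Matrix n n ℂ) :
    ‖A * B‖ ≤ Fintype.card n * (‖A‖ * ‖B‖) := by
  refine (Matrix.norm_le_iff (by positivity)).2 fun i j => ?_
  rw [Matrix.mul_apply]
  refine (norm_sum_le _ _).trans ?_
  refine (Finset.sum_le_card_nsmul _ _ (‖A‖ * ‖B‖) fun k _ => ?_).trans_eq (by simp)
  rw [norm_mul]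
  gcongr
  · exact A.norm_entry_le_entrywise_sup_norm
  · exact B.norm_entry_le_entrywise_sup_norm

theorem integrableOn_kernel_mul {ν : Measure (X × X)} {s : Set (X × X)}
    {k l : X → X → Matrix n n ℂ}
    (hk : Measurable (Function.uncurry k)) (hl : Measurable (Function.uncurry l))
    (h : IntegrableOn (fun p : X × X => ‖k p.1 p.2‖ * ‖l p.2 p.1‖) s ν) :
    IntegrableOn (ε := n → n → ℂ) (fun p : X × X => k p.1 p.2 * l p.2 p.1) s ν := by
  have hentry : ∀ {m : X → X → Matrix n n ℂ}, Measurable (Function.uncurry m) →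
      ∀ i j, Measurable fun p : X × X => m p.1 p.2 i j :=
    fun hm i j => measurable_pi_iff.1 (measurable_pi_iff.1 hm i) j
  have hmeas : Measurable (β := n → n → ℂ) fun p : X × X => k p.1 p.2 * l p.2 p.1 := by
    refine measurable_pi_iff.2 fun i => measurable_pi_iff.2 fun j => ?_
    simp only [Matrix.mul_apply]
    exact Finset.measurable_sum _ fun a _ =>
      (hentry hk i a).mul ((hentry hl a j).comp measurable_swap)
  exact (h.const_mul (Fintype.card n : ℝ)).mono' hmeas.stronglyMeasurable.aestronglyMeasurable
    (.of_forall fun p => Matrix.norm_mul_le_card_mul _ _)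

/-- The iterated trace integral is the integral of the trace over the product. -/
theorem setIntegral_trace_integral_kernel_mul {μ : Measure X} [SigmaFinite μ] {F : Set X}
    {k l : X → X → Matrix n n ℂ}
    (hk : Measurable (Function.uncurry k)) (hl : Measurable (Function.uncurry l))
    (h : IntegrableOn (fun p : X × X => ‖k p.1 p.2‖ * ‖l p.2 p.1‖)
      (F ×ˢ Set.univ) (μ.prod μ)) :
    ∫ x in F, Matrix.trace (∫ y, k x y * l y x ∂μ) ∂μ =
      ∫ p in F ×ˢ Set.univ, Matrix.trace (k p.1 p.2 * l p.2 p.1) ∂μ.prod μ := by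
  let T : (n → n → ℂ) →L[ℝ] ℂ :=
    LinearMap.toContinuousLinearMap (E := n → n → ℂ) (Matrix.traceLinearMap n ℝ ℂ)
  have hint := integrableOn_kernel_mul hk hl h
  have htrace : IntegrableOn (fun p : X × X => Matrix.trace (k p.1 p.2 * l p.2 p.1))
      (F ×ˢ Set.univ) (μ.prod μ) := T.integrable_comp hint
  rw [setIntegral_prod _ htrace]
  simp only [Measure.restrict_univ]
  have hint' : Integrable (ε := n → n → ℂ)
      (fun p : X × X => k p.1 p.2 * l p.2 p.1) ((μ.restrict F).prod μ) := by
    have hprod : (μ.prod μ).restrict (F ×ˢ Set.univ) = (μ.restrict F).prod μ := by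
      rw [← Measure.prod_restrict, Measure.restrict_univ]
    rw [← hprod]
    exact hint
  refine integral_congr_ae ?_
  filter_upwards [hint'.prod_right_ae] with x hx
  exact (T.integral_comp_comm hx).symm

end Kernel

theorem trace_kernel_mul_smul
    {Γ X : Type*} [SMul Γ X] {n : Type*} [Fintype n] {φ : Γ → X → ℝ}
    {k l : X → X → Matrix n n ℂ}
    (hk : ∀ (γ : Γ) (x y : X),
      Complex.exp (Complex.I * (φ γ x : ℝ)) •
        (Complex.exp (-(Complex.I * (φ γ y : ℝ))) • k (γ • x) (γ • y)) = k x y)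
    (hl : ∀ (γ : Γ) (x y : X),
      Complex.exp (Complex.I * (φ γ x : ℝ)) •
        (Complex.exp (-(Complex.I * (φ γ y : ℝ))) • l (γ • x) (γ • y)) = l x y)
    (γ : Γ) (x y : X) :
    Matrix.trace (k (γ • x) (γ • y) * l (γ • y) (γ • x)) = Matrix.trace (k x y * l y x) := by
  rw [← hk γ x y, ← hl γ y x]
  simp only [smul_mul_assoc, mul_smul_comm, smul_smul, ← Complex.exp_add]
  ring_nf
  simp

/-- Lemma A of the appendix: for kernels `k_A, k_B` satisfying the twisted
equivariance `e^{iφ_γ(x)} k(γx,γy) e^{−iφ_γ(y)} = k(x,y)` under a countable group of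
measure-preserving transformations with fundamental domain `F`, the Atiyah-type von
Neumann trace is symmetric: `tr(AB) = tr(BA)`. -/
theorem von_neumann_trace_symmetric
    {Γ X : Type*} [Group Γ] [Countable Γ] [MulAction Γ X] [MeasurableSpace X]
    (μ : Measure X) [SigmaFinite μ]
    (hmeas : ∀ γ : Γ, Measurable fun x : X => γ • x)
    (hpres : ∀ γ : Γ, MeasurePreserving (fun x : X => γ • x) μ μ)
    (F : Set X) (hF : IsFundamentalDomain Γ F μ)
    (φ : Γ → X → ℝ) (N : ℕ)
    (kA kB : X → X → Matrix (Fin N) (Fin N) ℂ)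
    (hkAmeas : Measurable (Function.uncurry kA))
    (hkBmeas : Measurable (Function.uncurry kB))
    (hkAequiv : ∀ (γ : Γ) (x y : X),
      Complex.exp (Complex.I * (φ γ x : ℝ)) •
        (Complex.exp (-(Complex.I * (φ γ y : ℝ))) • kA (γ • x) (γ • y)) = kA x y)
    (hkBequiv : ∀ (γ : Γ) (x y : X),
      Complex.exp (Complex.I * (φ γ x : ℝ)) •
        (Complex.exp (-(Complex.I * (φ γ y : ℝ))) • kB (γ • x) (γ • y)) = kB x y)
    (hintAB : IntegrableOn (fun p : X × X => ‖kA p.1 p.2‖ * ‖kB p.2 p.1‖)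
      (F ×ˢ Set.univ) (μ.prod μ))
    (hintBA : IntegrableOn (fun p : X × X => ‖kB p.1 p.2‖ * ‖kA p.2 p.1‖)
      (F ×ˢ Set.univ) (μ.prod μ)) :
    ∫ x in F, Matrix.trace (∫ y, kA x y * kB y x ∂μ) ∂μ =
      ∫ x in F, Matrix.trace (∫ y, kB x y * kA y x ∂μ) ∂μ := by
  rw [setIntegral_trace_integral_kernel_mul hkAmeas hkBmeas hintAB,
    setIntegral_trace_integral_kernel_mul hkBmeas hkAmeas hintBA,
    setIntegral_prod_swap_of_invariant hpres hF _
      fun γ p => trace_kernel_mul_smul hkAequiv hkBequiv γ p.1 p.2]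
  simp only [Prod.fst_swap, Prod.snd_swap, Matrix.trace_mul_comm (kA _ _)]
end
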